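/- arXiv:1506.02155 — 2 statements merged into one kernel-verified Lean document; each statement's English description precedes it below -/
import Mathlib

section
/- (McDiarmid's inequality.) Let X₁,…,X_m be independent 𝒳-valued random variables and let f : 𝒳^m → ℝ be measurable and satisfy the bounded difference property: for every r ∈ {1,…,m}, sup over u₁,…,u_m, u_r' ∈ 𝒳 of |f(u₁,…,u_m) − f(u₁,…,u_{r−1},u_r',u_{r+1},…,u_m)| ≤ c_r. Then for every ε > 0, P( f(X₁,…,X_m) − E[f(X₁,…,X_m)] ≥ ε ) ≤ exp(−2ε² / Σ_{r=1}^m c_r²). -/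
open MeasureTheory ProbabilityTheory

lemma mcd_bound {𝒳 : Type*} : ∀ (n : ℕ) (f : (Fin n → 𝒳) → ℝ) (c : Fin n → ℝ)
    (_ : ∀ (r : Fin n) (u : Fin n → 𝒳) (u' : 𝒳), |f u - f (Function.update u r u')| ≤ c r)
    (u v : Fin n → 𝒳), |f u - f v| ≤ ∑ r, c r := by
  intro n
  induction n with
  | zero => intro f c _ u v; simp [Subsingleton.elim u v]
  | succ n ih =>
    intro f c h u v
    rw [Fin.sum_univ_succ]
    have h1 := h 0 u (v 0)
    have h2 := ih (fun y => f (Fin.cons (v 0) y)) (fun i => c i.succ)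
      (fun r w w' => by
        have := h r.succ (Fin.cons (v 0) w) w'
        rwa [← Fin.cons_update] at this) (Fin.tail u) (Fin.tail v)
    have h3 : Function.update u 0 (v 0) = Fin.cons (v 0) (Fin.tail u) := by
      conv_lhs => rw [← Fin.cons_self_tail u]
      rw [Fin.update_cons_zero]
    rw [h3] at h1
    simp only [Fin.cons_self_tail] at h2
    exact (abs_sub_le _ _ _).trans (add_le_add h1 h2)

lemma mcd_integrable {α : Type*} [MeasurableSpace α] (μ : Measure α) [IsProbabilityMeasure μ]
    (g : α → ℝ) (hg : Measurable g) (C : ℝ) (hC : ∀ x, |g x| ≤ C) : Integrable g μ :=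
  Integrable.of_bound hg.aestronglyMeasurable C (Filter.Eventually.of_forall hC)

lemma mcd_integrable_exp {α : Type*} [MeasurableSpace α] (μ : Measure α) [IsProbabilityMeasure μ]
    (g : α → ℝ) (hg : Measurable g) (C : ℝ) (hC : ∀ x, |g x| ≤ C) (t a : ℝ) :
    Integrable (fun x => Real.exp (t * (g x - a))) μ := by
  refine mcd_integrable μ _ (by fun_prop) (Real.exp (|t| * (C + |a|))) fun x => ?_
  rw [abs_of_pos (Real.exp_pos _), Real.exp_le_exp]
  refine (le_abs_self _).trans ?_
  rw [abs_mul]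
  gcongr
  exact (abs_sub _ _).trans (by linarith [hC x])

lemma mcd_hoeffding {α : Type*} [MeasurableSpace α] (μ : Measure α) [IsProbabilityMeasure μ]
    (g : α → ℝ) (hg : Measurable g) (C : ℝ) (hC : ∀ x, |g x| ≤ C) (c : ℝ)
    (h : ∀ x y, |g x - g y| ≤ c) (t : ℝ) :
    ∫ x, Real.exp (t * (g x - ∫ y, g y ∂μ)) ∂μ ≤ Real.exp (t ^ 2 * c ^ 2 / 8) := by
  have hne : Nonempty α := nonempty_of_isProbabilityMeasure μ
  have hbb : BddBelow (Set.range g) := ⟨-C, by rintro _ ⟨x, rfl⟩; exact (abs_le.1 (hC x)).1⟩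
  have := (hasSubgaussianMGF_of_mem_Icc (μ := μ) (X := g) (a := ⨅ x, g x) (b := (⨅ x, g x) + c)
    hg.aemeasurable (Filter.Eventually.of_forall fun x => ⟨ciInf_le hbb x, by
      have : g x - c ≤ ⨅ y, g y := le_ciInf fun y => by linarith [(abs_le.1 (h x y)).2]
      linarith⟩)).mgf_le t
  refine this.trans (Real.exp_le_exp.2 (le_of_eq ?_))
  simp only [add_sub_cancel_left]
  push_cast
  rw [div_pow, Real.norm_eq_abs, sq_abs]
  ring

lemma mcd_mgf {𝒳 : Type*} [MeasurableSpace 𝒳] : ∀ (n : ℕ) (ν : Fin n → Measure 𝒳)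
    (_ : ∀ i, IsProbabilityMeasure (ν i)) (f : (Fin n → 𝒳) → ℝ) (_ : Measurable f)
    (C : ℝ) (_ : ∀ u, |f u| ≤ C) (c : Fin n → ℝ)
    (_ : ∀ (r : Fin n) (u : Fin n → 𝒳) (u' : 𝒳), |f u - f (Function.update u r u')| ≤ c r)
    (t : ℝ),
    ∫ u, Real.exp (t * (f u - ∫ v, f v ∂(Measure.pi ν))) ∂(Measure.pi ν)
      ≤ Real.exp (t ^ 2 * (∑ r, c r ^ 2) / 8) := by
  intro n
  induction n with
  | zero =>
    intro ν hν f hf C hC c h t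
    have : ∀ u, f u = f default := fun u => by rw [Subsingleton.elim u default]
    simp [this]
  | succ n ih =>
    intro ν hν f hf C hC c h t
    set P := Measure.pi (fun i : Fin n => ν i.succ) with hP
    have hmp := (measurePreserving_piFinSuccAbove ν 0).symm
    have key : ∀ F : (Fin (n+1) → 𝒳) → ℝ, ∫ u, F u ∂(Measure.pi ν) =
        ∫ p, F (Fin.cons p.1 p.2) ∂((ν 0).prod P) := by
      intro F
      rw [← hmp.integral_comp (MeasurableEquiv.measurableEmbedding _) F]
      simp [MeasurableEquiv.piFinSuccAbove, Fin.insertNthEquiv, hP]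
    have hcons : Measurable (fun p : 𝒳 × (Fin n → 𝒳) => (Fin.cons p.1 p.2 : Fin (n+1) → 𝒳)) := by
      refine measurable_pi_iff.2 fun i => ?_
      refine Fin.cases ?_ (fun j => ?_) i
      · simpa using measurable_fst
      · simp only [Fin.cons_succ]; exact (measurable_pi_apply j).comp measurable_snd
    have hF : Measurable (fun p : 𝒳 × (Fin n → 𝒳) => f (Fin.cons p.1 p.2)) := hf.comp hcons
    have hFy : ∀ y : Fin n → 𝒳, Measurable (fun x => f (Fin.cons x y)) := fun y =>
      hF.comp (measurable_id.prodMk measurable_const)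
    have hFyi : ∀ y : Fin n → 𝒳, Integrable (fun x => f (Fin.cons x y)) (ν 0) := fun y =>
      mcd_integrable _ _ (hFy y) C fun x => hC _
    set g : (Fin n → 𝒳) → ℝ := fun y => ∫ x, f (Fin.cons x y) ∂(ν 0) with hg
    have hgm : Measurable g :=
      (StronglyMeasurable.integral_prod_left' (μ := ν 0) hF.stronglyMeasurable).measurable
    have hb : ∀ (F : 𝒳 → ℝ) (D : ℝ), (∀ x, |F x| ≤ D) → |∫ x, F x ∂(ν 0)| ≤ D := by
      intro F D hD
      have := norm_integral_le_of_norm_le_const (μ := ν 0) (f := F) (C := D)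
        (Filter.Eventually.of_forall hD)
      simpa using this
    have hgC : ∀ y, |g y| ≤ C := fun y => hb _ _ fun x => hC _
    have hgd : ∀ (r : Fin n) (u : Fin n → 𝒳) (u' : 𝒳),
        |g u - g (Function.update u r u')| ≤ c r.succ := by
      intro r u u'
      simp only [hg]
      rw [← integral_sub (hFyi _) (hFyi _)]
      refine hb _ _ fun x => ?_
      rw [Fin.cons_update]
      exact h _ _ _
    have hE : ∫ v, f v ∂(Measure.pi ν) = ∫ y, g y ∂P := by
      rw [key, integral_prod_symm _ (mcd_integrable _ _ hF C fun p => hC _)]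
    have ih' := ih (fun i => ν i.succ) (fun i => hν _) g hgm C hgC (fun i => c i.succ) hgd t
    rw [← hP] at ih'
    rw [hE, key]
    set E := ∫ y, g y ∂P
    have hI : Integrable (fun p : 𝒳 × (Fin n → 𝒳) => Real.exp (t * (f (Fin.cons p.1 p.2) - E)))
      ((ν 0).prod P) := mcd_integrable_exp _ _ hF C (fun p => hC _) t E
    rw [integral_prod_symm _ hI]
    have hstep : ∀ y, ∫ x, Real.exp (t * (f (Fin.cons x y) - E)) ∂(ν 0) ≤
        Real.exp (t ^ 2 * c 0 ^ 2 / 8) * Real.exp (t * (g y - E)) := by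
      intro y
      have h1 := mcd_hoeffding (ν 0) (fun x => f (Fin.cons x y)) (hFy y) C (fun x => hC _) (c 0)
        (fun x x' => by
          have := h 0 (Fin.cons x y) x'
          rwa [Fin.update_cons_zero] at this) t
      have h2 : ∀ x, Real.exp (t * (f (Fin.cons x y) - E)) =
          Real.exp (t * (f (Fin.cons x y) - g y)) * Real.exp (t * (g y - E)) := by
        intro x; rw [← Real.exp_add]; ring_nf
      simp_rw [h2]
      rw [integral_mul_const]
      exact mul_le_mul_of_nonneg_right h1 (Real.exp_pos _).le
    refine (integral_mono hI.integral_prod_right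
      ((mcd_integrable_exp P g hgm C hgC t E).const_mul _) hstep).trans ?_
    rw [integral_const_mul, Fin.sum_univ_succ]
    refine (mul_le_mul_of_nonneg_left ih' (Real.exp_pos _).le).trans (le_of_eq ?_)
    rw [← Real.exp_add]; ring_nf


/-- McDiarmid's inequality. -/
theorem mcdiarmid_inequality {Ω 𝒳 : Type*} [MeasurableSpace Ω] [MeasurableSpace 𝒳]
    (μ : Measure Ω) [IsProbabilityMeasure μ]
    (m : ℕ) (hm : 1 ≤ m)
    (X : Fin m → Ω → 𝒳) (hXmeas : ∀ i, Measurable (X i))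
    (hXindep : iIndepFun X μ)
    (f : (Fin m → 𝒳) → ℝ) (hfmeas : Measurable f)
    (c : Fin m → ℝ) (hc : ∀ r, 0 ≤ c r)
    (hbd : ∀ (r : Fin m) (u : Fin m → 𝒳) (u' : 𝒳),
      |f u - f (Function.update u r u')| ≤ c r)
    (hint : Integrable (fun ω => f (fun i => X i ω)) μ)
    (ε : ℝ) (hε : 0 < ε) :
    μ {ω | ε ≤ f (fun i => X i ω) - ∫ ω', f (fun i => X i ω') ∂μ} ≤
      ENNReal.ofReal (Real.exp (-2 * ε ^ 2 / ∑ r, c r ^ 2)) := by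
  have hν : ∀ i, IsProbabilityMeasure (μ.map (X i)) := fun i =>
    Measure.isProbabilityMeasure_map (hXmeas i).aemeasurable
  have hmap := (iIndepFun_iff_map_fun_eq_pi_map fun i => (hXmeas i).aemeasurable).1 hXindep
  have hX : Measurable (fun ω i => X i ω) := measurable_pi_iff.2 hXmeas
  obtain ⟨ω₀⟩ : Nonempty Ω := nonempty_of_isProbabilityMeasure μ
  obtain ⟨C, hC⟩ : ∃ C, ∀ u, |f u| ≤ C :=
    ⟨∑ r, c r + |f (fun i => X i ω₀)|, fun u => by
      have h1 := mcd_bound m f c hbd u (fun i => X i ω₀)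
      have h2 := abs_sub_abs_le_abs_sub (f u) (f (fun i => X i ω₀))
      linarith⟩
  have hE : ∀ F : (Fin m → 𝒳) → ℝ, Measurable F →
      ∫ ω, F (fun i => X i ω) ∂μ = ∫ u, F u ∂(Measure.pi fun i => μ.map (X i)) := by
    intro F hF
    rw [← hmap, integral_map hX.aemeasurable hF.aestronglyMeasurable]
  have hs : 0 ≤ (∑ r, c r ^ 2) / 4 := by positivity
  have hsub : HasSubgaussianMGF (fun ω => f (fun i => X i ω) - ∫ ω', f (fun i => X i ω') ∂μ)
      ⟨(∑ r, c r ^ 2) / 4, hs⟩ μ := by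
    refine ⟨fun t => mcd_integrable_exp μ _ (hfmeas.comp hX) C (fun ω => hC _) t _, fun t => ?_⟩
    have := mcd_mgf m (fun i => μ.map (X i)) hν f hfmeas C hC c hbd t
    rw [← hE f hfmeas, ← hE (fun u => Real.exp (t * (f u - ∫ ω', f (fun i => X i ω') ∂μ)))
      (by fun_prop)] at this
    refine this.trans (Real.exp_le_exp.2 (le_of_eq ?_))
    change _ = (∑ r, c r ^ 2) / 4 * t ^ 2 / 2
    ring
  have hfin := hsub.measure_ge_le hε.le
  rw [← ofReal_measureReal]
  refine ENNReal.ofReal_le_ofReal (hfin.trans (Real.exp_le_exp.2 (le_of_eq ?_)))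
  change -ε ^ 2 / (2 * ((∑ r, c r ^ 2) / 4)) = _
  rcases eq_or_ne (∑ r, c r ^ 2) 0 with h0 | h0
  · simp [h0]
  · field_simp; norm_num
end

section
/- Let Λ be a Borel probability measure on ℝ^d, k(x, y) := ∫_{ℝ^d} cos(⟨ω, x − y⟩) dΛ(ω), ω₁,…,ω_m i.i.d. with law Λ, and k̂(x, y) := (1/m) Σ_{j=1}^m cos(⟨ω_j, x − y⟩). Let 𝒮 ⊂ ℝ^d be a compact set of Lebesgue measure vol(𝒮), let r ∈ (1, ∞), set q := min(2, r), and let C > 0 be a constant such that for every finite family f₁,…,f_N ∈ L^r(𝒮×𝒮), 2^{−N} Σ_{ε ∈ {−1,1}^N} ‖Σ_{j=1}^N ε_j f_j‖_{L^r(𝒮×𝒮)} ≤ C·( Σ_{j=1}^N ‖f_j‖_{L^r(𝒮×𝒮)}^q )^{1/q}. Then for every τ > 0, with probability at least 1 − e^{−τ} over the sample (ω_j)_{j=1}^m, ‖k − k̂‖_{L^r(𝒮×𝒮)} ≤ vol(𝒮)^{2/r}·( 2C·m^{max(1/2, 1/r) − 1} + √(2τ/m) ). -/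
open MeasureTheory RealInnerProductSpace

/-- The `L^r` norm on `𝒮 × 𝒮` (w.r.t. Lebesgue measure) of a real function. -/
noncomputable def lrnorm (d : ℕ) (S : Set (EuclideanSpace ℝ (Fin d))) (r : ℝ)
    (f : EuclideanSpace ℝ (Fin d) × EuclideanSpace ℝ (Fin d) → ℝ) : ℝ :=
  (∫ z in S ×ˢ S, |f z| ^ r) ^ (1 / r)

lemma rff_integrable_of_bdd {α : Type*} [MeasurableSpace α] (μ : Measure α) [IsFiniteMeasure μ]
    {F : α → ℝ} (hF : Measurable F) {B : ℝ} (hB : ∀ a, |F a| ≤ B) : Integrable F μ :=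
  Integrable.of_bound hF.aestronglyMeasurable B (Filter.Eventually.of_forall hB)

/-- Hoeffding lemma for a function of oscillation at most `c`. -/
lemma rff_hoeffding {Ω : Type*} [MeasurableSpace Ω] (Λ : Measure Ω) [IsProbabilityMeasure Λ]
    (f : Ω → ℝ) (hf : Measurable f) (B : ℝ) (hB : ∀ a, |f a| ≤ B) (c : ℝ)
    (hc : ∀ a b, |f a - f b| ≤ c) :
    ∫ a, Real.exp (f a) ∂Λ ≤ Real.exp (∫ a, f a ∂Λ + c ^ 2 / 8) := by
  have hne : Nonempty Ω := Λ.nonempty_of_neZero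
  have hbd : BddBelow (Set.range f) := ⟨-B, by rintro _ ⟨a, rfl⟩; exact (abs_le.1 (hB a)).1⟩
  have hmem : ∀ a, f a ∈ Set.Icc (⨅ b, f b) ((⨅ b, f b) + c) := by
    intro a
    refine ⟨ciInf_le hbd a, ?_⟩
    have : f a - c ≤ ⨅ b, f b := le_ciInf fun b => by linarith [(abs_le.1 (hc a b)).2]
    linarith
  have h := (ProbabilityTheory.hasSubgaussianMGF_of_mem_Icc (μ := Λ) hf.aemeasurable
    (Filter.Eventually.of_forall hmem)).mgf_le 1
  simp only [ProbabilityTheory.mgf, one_mul, Real.exp_sub] at h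
  rw [integral_div, div_le_iff₀ (Real.exp_pos _), ← Real.exp_add] at h
  refine h.trans (le_of_eq ?_)
  congr 1
  simp only [add_sub_cancel_left]
  push_cast
  rw [Real.norm_eq_abs, div_pow, sq_abs]
  ring

lemma rff_mcdiarmid_mgf {Ω : Type*} [MeasurableSpace Ω] (Λ : Measure Ω) [IsProbabilityMeasure Λ]
    (c : ℝ) (B : ℝ) : ∀ (n : ℕ)
    (F : (Fin n → Ω) → ℝ) (_ : Measurable F) (_ : ∀ a, |F a| ≤ B)
    (_ : ∀ w i a, |F (Function.update w i a) - F w| ≤ c),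
    ∫ w, Real.exp (F w) ∂(Measure.pi fun _ : Fin n => Λ) ≤
      Real.exp (∫ w, F w ∂(Measure.pi fun _ : Fin n => Λ) + n * (c ^ 2 / 8)) := by
  intro n
  induction n with
  | zero =>
    intro F hF hB hc
    have : ∀ w, F w = F default := fun w => congrArg F (Subsingleton.elim _ _)
    simp [this]
  | succ n ih =>
    intro F hF hB hc
    have mp := (measurePreserving_piFinSuccAbove (fun _ : Fin (n+1) => Λ) 0).symm
    have key : ∀ H : (Fin (n+1) → Ω) → ℝ, Measurable H → (∃ D, ∀ a, |H a| ≤ D) →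
        ∫ w, H w ∂(Measure.pi fun _ : Fin (n+1) => Λ) =
        ∫ w', ∫ a, H (Fin.cons a w') ∂Λ ∂(Measure.pi fun _ : Fin n => Λ) := by
      rintro H hH ⟨D, hD⟩
      rw [← mp.integral_comp']
      rw [integral_prod_symm]
      · simp [MeasurableEquiv.piFinSuccAbove_symm_apply, Fin.insertNthEquiv]
      · exact rff_integrable_of_bdd _ (hH.comp (MeasurableEquiv.measurable _)) (fun a => hD _)
    have hcons : Measurable fun p : (Fin n → Ω) × Ω => (Fin.cons p.2 p.1 : Fin (n+1) → Ω) := by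
      refine measurable_pi_lambda _ fun i => ?_
      refine Fin.cases ?_ (fun j => ?_) i
      · simpa using measurable_snd
      · simp only [Fin.cons_succ]; fun_prop
    have hFc : Measurable fun p : (Fin n → Ω) × Ω => F (Fin.cons p.2 p.1) := hF.comp hcons
    have hFw : ∀ w' : Fin n → Ω, Measurable fun a => F (Fin.cons a w') := fun w' =>
      hFc.comp measurable_prodMk_left
    set G : (Fin n → Ω) → ℝ := fun w' => ∫ a, F (Fin.cons a w') ∂Λ with hG
    have hGm : Measurable G := (hFc.stronglyMeasurable.integral_prod_right).measurable
    have hGB : ∀ w', |G w'| ≤ B := fun w' => by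
      have := norm_integral_le_of_norm_le_const (μ := Λ)
        (f := fun a => F (Fin.cons a w')) (C := B) (Filter.Eventually.of_forall fun a => hB _)
      simpa using this
    have hGc : ∀ w i a, |G (Function.update w i a) - G w| ≤ c := fun w i a => by
      simp only [hG]
      rw [← integral_sub (rff_integrable_of_bdd _ (hFw _) fun _ => hB _)
        (rff_integrable_of_bdd _ (hFw _) fun _ => hB _)]
      have := norm_integral_le_of_norm_le_const (μ := Λ)
        (f := fun b => F (Fin.cons b (Function.update w i a)) - F (Fin.cons b w)) (C := c)
        (Filter.Eventually.of_forall fun b => by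
          rw [Fin.cons_update]; exact hc _ _ _)
      simpa using this
    have hexp : ∀ x, |x| ≤ B → |Real.exp x| ≤ Real.exp B := fun x hx => by
      rw [Real.abs_exp]; exact Real.exp_le_exp.2 (abs_le.1 hx).2
    rw [key F hF ⟨B, hB⟩, key (fun w => Real.exp (F w)) (Real.measurable_exp.comp hF)
      ⟨Real.exp B, fun a => hexp _ (hB a)⟩]
    calc _ ≤ ∫ w', Real.exp (G w') * Real.exp (c ^ 2 / 8) ∂(Measure.pi fun _ : Fin n => Λ) := by
            apply integral_mono_of_nonneg
            · exact Filter.Eventually.of_forall fun w' => integral_nonneg fun _ => (Real.exp_pos _).le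
            · exact (rff_integrable_of_bdd _ (Real.measurable_exp.comp hGm)
                fun a => hexp _ (hGB a)).mul_const _
            · refine Filter.Eventually.of_forall fun w' => ?_
              simp only
              rw [← Real.exp_add]
              refine rff_hoeffding Λ _ (hFw w') B (fun _ => hB _) c fun a b => ?_
              have := hc (Fin.cons b w') 0 a
              rwa [Fin.update_cons_zero] at this
      _ ≤ Real.exp (∫ w, G w ∂(Measure.pi fun _ : Fin n => Λ) + n * (c ^ 2 / 8))
            * Real.exp (c ^ 2 / 8) := by
            rw [integral_mul_const]
            exact mul_le_mul_of_nonneg_right (ih G hGm hGB hGc) (Real.exp_pos _).le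
      _ = _ := by
            rw [← Real.exp_add]; congr 1; push_cast; ring

lemma rff_mcdiarmid {Ω : Type*} [MeasurableSpace Ω] (Λ : Measure Ω) [IsProbabilityMeasure Λ]
    (n : ℕ) (c : ℝ) (B : ℝ)
    (F : (Fin n → Ω) → ℝ) (hF : Measurable F) (hB : ∀ a, |F a| ≤ B)
    (hc : ∀ w i a, |F (Function.update w i a) - F w| ≤ c) (t : ℝ) (ht : 0 ≤ t) :
    (Measure.pi fun _ : Fin n => Λ).real
      {w | t ≤ F w - ∫ w, F w ∂(Measure.pi fun _ : Fin n => Λ)} ≤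
      Real.exp (- t ^ 2 / (2 * (n * c ^ 2 / 4))) := by
  set P := (Measure.pi fun _ : Fin n => Λ) with hP
  have hsub : ProbabilityTheory.HasSubgaussianMGF (fun w => F w - ∫ w, F w ∂P)
      (Real.toNNReal (n * c ^ 2 / 4)) P := by
    refine ⟨fun s => ?_, fun s => ?_⟩
    · refine rff_integrable_of_bdd _ (by fun_prop) (B := Real.exp (|s| * (B + |∫ w, F w ∂P|)))
        fun w => ?_
      rw [Real.abs_exp]
      refine Real.exp_le_exp.2 ((le_abs_self _).trans ?_)
      rw [abs_mul]
      refine mul_le_mul_of_nonneg_left ?_ (abs_nonneg _)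
      exact (abs_sub _ _).trans (add_le_add_left (hB w) _)
    · have h := rff_mcdiarmid_mgf Λ (|s| * c) (|s| * B) n (fun w => s * F w) (hF.const_mul s)
        (fun a => by rw [abs_mul]; exact mul_le_mul_of_nonneg_left (hB a) (abs_nonneg _))
        (fun w i a => by
          rw [← mul_sub, abs_mul]; exact mul_le_mul_of_nonneg_left (hc w i a) (abs_nonneg _))
      rw [← hP, integral_const_mul] at h
      simp only [ProbabilityTheory.mgf, mul_sub, Real.exp_sub]
      rw [integral_div, div_le_iff₀ (Real.exp_pos _), ← Real.exp_add]
      refine h.trans (le_of_eq ?_)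
      congr 1
      rw [mul_pow, sq_abs]
      rw [Real.coe_toNNReal _ (by positivity)]
      ring
  have := hsub.measure_ge_le ht
  rwa [Real.coe_toNNReal _ (by positivity)] at this

/-- Symmetrization. -/
lemma rff_symm {Ω : Type*} [TopologicalSpace Ω] [SecondCountableTopology Ω] [MeasurableSpace Ω]
    [BorelSpace Ω] (Λ : Measure Ω) [IsProbabilityMeasure Λ]
    {E : Type*} [NormedAddCommGroup E] [NormedSpace ℝ E] [CompleteSpace E]
    (X : Ω → E) (hX : Continuous X) (V : ℝ) (hV : ∀ a, ‖X a‖ ≤ V) (m : ℕ) (D : ℝ)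
    (hD : ∀ w : Fin m → Ω, (2 ^ m : ℝ)⁻¹ * ∑ ε : Fin m → Bool,
      ‖∑ j, (if ε j then (1 : ℝ) else -1) • X (w j)‖ ≤ D) :
    ∫ w, ‖∑ j, ((∫ a, X a ∂Λ) - X (w j))‖ ∂(Measure.pi fun _ : Fin m => Λ) ≤ 2 * D := by
  set P := (Measure.pi fun _ : Fin m => Λ) with hP
  set Q := (Measure.pi fun _ : Fin m => Λ.prod Λ) with hQ
  have hXi : Integrable X Λ := Integrable.of_bound hX.aestronglyMeasurable V
    (Filter.Eventually.of_forall hV)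
  have hmean : ∀ j : Fin m, ∫ w, X (w j) ∂P = ∫ a, X a ∂Λ := fun j =>
    integral_comp_eval (μ := fun _ : Fin m => Λ) (i := j) hX.aestronglyMeasurable
  have hXij : ∀ j : Fin m, Integrable (fun w : Fin m → Ω => X (w j)) P := fun j =>
    Integrable.of_bound (hX.comp (continuous_apply j)).aestronglyMeasurable V
      (Filter.Eventually.of_forall fun w => hV _)
  have hbound : ∀ (s : Fin m → ℝ) (hs : ∀ j, |s j| ≤ 1) (w : Fin m → Ω),
      ‖∑ j, s j • X (w j)‖ ≤ m * V := fun s hs w => by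
    refine (norm_sum_le _ _).trans ?_
    calc _ ≤ ∑ j : Fin m, V := Finset.sum_le_sum fun j _ => by
            rw [norm_smul]
            have := mul_le_mul (hs j) (hV (w j)) (norm_nonneg _) zero_le_one
            simpa using this
      _ = _ := by simp
  have hone : ∀ w : Fin m → Ω, ‖∑ j, X (w j)‖ ≤ m * V := fun w => by
    simpa using hbound (fun _ => 1) (by simp) w
  -- Jensen
  have h1 : ∫ w, ‖∑ j, ((∫ a, X a ∂Λ) - X (w j))‖ ∂P ≤
      ∫ u, ‖∑ j, (X ((u j).1) - X ((u j).2))‖ ∂Q := by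
    have mp := measurePreserving_arrowProdEquivProdArrow Ω Ω (Fin m) (fun _ => Λ) (fun _ => Λ)
    have hint : Integrable (fun p : (Fin m → Ω) × (Fin m → Ω) =>
        ‖∑ j, (X (p.1 j) - X (p.2 j))‖) (P.prod P) := by
      refine rff_integrable_of_bdd _ (Continuous.measurable (by fun_prop)) (B := m * V + m * V)
        fun p => ?_
      rw [abs_norm, Finset.sum_sub_distrib]
      exact (norm_sub_le _ _).trans (add_le_add (hone _) (hone _))
    have e : ∫ u, ‖∑ j, (X ((u j).1) - X ((u j).2))‖ ∂Q =
        ∫ p, ‖∑ j, (X (p.1 j) - X (p.2 j))‖ ∂(P.prod P) := by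
      rw [← mp.integral_comp']
      rfl
    rw [e, integral_prod_symm _ hint]
    refine integral_mono_of_nonneg (Filter.Eventually.of_forall fun w => norm_nonneg _)
      hint.integral_prod_right (Filter.Eventually.of_forall fun w => ?_)
    simp only
    have : ∑ j, ((∫ a, X a ∂Λ) - X (w j)) = ∫ w', ∑ j, (X (w' j) - X (w j)) ∂P := by
      rw [integral_finsetSum (f := fun j (w' : Fin m → Ω) => X (w' j) - X (w j)) _
        fun j _ => (hXij j).sub (integrable_const _)]
      refine Finset.sum_congr rfl fun j _ => ?_
      rw [integral_sub (hXij j) (integrable_const _), hmean]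
      simp
    rw [this]
    exact norm_integral_le_integral_norm _
  -- sign invariance
  have h2 : ∀ ε : Fin m → Bool, ∫ u, ‖∑ j, (X ((u j).1) - X ((u j).2))‖ ∂Q ≤
      2 * ∫ w, ‖∑ j, (if ε j then (1 : ℝ) else -1) • X (w j)‖ ∂P := fun ε => by
    have mpe : MeasurePreserving (fun (u : Fin m → Ω × Ω) (j : Fin m) =>
        (if ε j then id else Prod.swap) (u j)) Q Q := by
      refine measurePreserving_pi _ _ fun j => ?_
      by_cases h : ε j
      · simp only [h, if_true]; exact MeasurePreserving.id _
      · simp only [h]; exact Measure.measurePreserving_swap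
    have mp1 : MeasurePreserving (fun (u : Fin m → Ω × Ω) (j : Fin m) => (u j).1) Q P :=
      measurePreserving_pi _ _ fun j => measurePreserving_fst
    have mp2 : MeasurePreserving (fun (u : Fin m → Ω × Ω) (j : Fin m) => (u j).2) Q P :=
      measurePreserving_pi _ _ fun j => measurePreserving_snd
    set g : (Fin m → Ω) → ℝ := fun w => ‖∑ j, (if ε j then (1 : ℝ) else -1) • X (w j)‖ with hg
    have hgc : Continuous g := by fun_prop
    have hgB : ∀ w, |g w| ≤ m * V := fun w => by
      rw [hg, abs_norm]
      exact hbound (fun j => if ε j then (1 : ℝ) else -1) (fun j => by split_ifs <;> simp) w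
    have hcont : Continuous fun u : Fin m → Ω × Ω => ‖∑ j, (X ((u j).1) - X ((u j).2))‖ := by
      fun_prop
    have e1 : ∫ u, ‖∑ j, (X ((u j).1) - X ((u j).2))‖ ∂Q =
        ∫ u, ‖∑ j, (if ε j then (1 : ℝ) else -1) • (X ((u j).1) - X ((u j).2))‖ ∂Q := by
      conv_lhs => rw [← mpe.map_eq]
      rw [integral_map mpe.measurable.aemeasurable hcont.measurable.aestronglyMeasurable]
      refine integral_congr_ae (Filter.Eventually.of_forall fun u => ?_)
      simp only
      congr 1
      refine Finset.sum_congr rfl fun j _ => ?_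
      by_cases h : ε j <;> simp [h]
    have i1 : ∫ u, g (fun j => (u j).1) ∂Q = ∫ w, g w ∂P := by
      rw [← mp1.map_eq, integral_map mp1.measurable.aemeasurable
        hgc.measurable.aestronglyMeasurable]
    have i2 : ∫ u, g (fun j => (u j).2) ∂Q = ∫ w, g w ∂P := by
      rw [← mp2.map_eq, integral_map mp2.measurable.aemeasurable
        hgc.measurable.aestronglyMeasurable]
    have I1 : Integrable (fun u => g (fun j => (u j).1)) Q :=
      rff_integrable_of_bdd _ (hgc.measurable.comp mp1.measurable) fun u => hgB _
    have I2 : Integrable (fun u => g (fun j => (u j).2)) Q :=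
      rff_integrable_of_bdd _ (hgc.measurable.comp mp2.measurable) fun u => hgB _
    calc _ ≤ ∫ u, (g (fun j => (u j).1) + g (fun j => (u j).2)) ∂Q := by
            rw [e1]
            refine integral_mono_of_nonneg (Filter.Eventually.of_forall fun w => norm_nonneg _)
              (I1.add I2) (Filter.Eventually.of_forall fun u => ?_)
            simp only [smul_sub, Finset.sum_sub_distrib]
            exact norm_sub_le _ _
      _ = _ := by rw [integral_add I1 I2, i1, i2]; ring
  have hIε : ∀ ε : Fin m → Bool, Integrable
      (fun w : Fin m → Ω => ‖∑ j, (if ε j then (1 : ℝ) else -1) • X (w j)‖) P := fun ε => by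
    refine rff_integrable_of_bdd _ (Continuous.measurable (by fun_prop)) (B := m * V) fun w => ?_
    rw [abs_norm]
    exact hbound (fun j => if ε j then (1 : ℝ) else -1) (fun j => by split_ifs <;> simp) w
  refine h1.trans ?_
  set K := ∫ u, ‖∑ j, (X ((u j).1) - X ((u j).2))‖ ∂Q with hK
  have h3 : (2 ^ m : ℝ)⁻¹ * ∑ ε : Fin m → Bool, K ≤ (2 ^ m : ℝ)⁻¹ * ∑ ε : Fin m → Bool,
      2 * ∫ w, ‖∑ j, (if ε j then (1 : ℝ) else -1) • X (w j)‖ ∂P :=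
    mul_le_mul_of_nonneg_left (Finset.sum_le_sum fun ε _ => h2 ε) (by positivity)
  have h4 : (2 ^ m : ℝ)⁻¹ * ∑ ε : Fin m → Bool, K = K := by
    simp
  have h5 : (2 ^ m : ℝ)⁻¹ * ∑ ε : Fin m → Bool,
      2 * ∫ w, ‖∑ j, (if ε j then (1 : ℝ) else -1) • X (w j)‖ ∂P =
      2 * ∫ w, (2 ^ m : ℝ)⁻¹ * ∑ ε : Fin m → Bool,
      ‖∑ j, (if ε j then (1 : ℝ) else -1) • X (w j)‖ ∂P := by
    rw [integral_const_mul, integral_finsetSum _ fun ε _ => hIε ε, ← Finset.mul_sum]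
    ring
  rw [h4, h5] at h3
  refine h3.trans (mul_le_mul_of_nonneg_left ?_ zero_le_two)
  calc _ ≤ ∫ w, D ∂P := integral_mono
        ((integrable_finsetSum _ fun ε _ => hIε ε).const_mul _) (integrable_const _) hD
    _ = D := by simp

lemma rff_abstract {Ω : Type*} [TopologicalSpace Ω] [SecondCountableTopology Ω] [MeasurableSpace Ω]
    [BorelSpace Ω] (Λ : Measure Ω) [IsProbabilityMeasure Λ]
    {E : Type*} [NormedAddCommGroup E] [NormedSpace ℝ E] [CompleteSpace E]
    (X : Ω → E) (hX : Continuous X) (V : ℝ) (hV : ∀ a, ‖X a‖ ≤ V) (m : ℕ) (hm : 1 ≤ m) (D : ℝ)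
    (hD : ∀ w : Fin m → Ω, (2 ^ m : ℝ)⁻¹ * ∑ ε : Fin m → Bool,
      ‖∑ j, (if ε j then (1 : ℝ) else -1) • X (w j)‖ ≤ D) (τ : ℝ) (hτ : 0 < τ) :
    1 - ENNReal.ofReal (Real.exp (-τ)) ≤ (Measure.pi fun _ : Fin m => Λ)
      {w | ‖(∫ a, X a ∂Λ) - (1 / m : ℝ) • ∑ j, X (w j)‖ ≤
        2 * D / m + V * Real.sqrt (2 * τ / m)} := by
  have hm0 : (0 : ℝ) < m := by exact_mod_cast hm
  have hne : Nonempty Ω := Λ.nonempty_of_neZero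
  have hV0 : 0 ≤ V := (norm_nonneg _).trans (hV hne.some)
  have hD0 : 0 ≤ D := le_trans (by positivity) (hD fun _ => hne.some)
  rcases hV0.eq_or_lt with h0 | hVpos
  · have hX0 : ∀ a, X a = 0 := fun a => norm_le_zero_iff.1 (h0 ▸ hV a)
    have : {w : Fin m → Ω | ‖(∫ a, X a ∂Λ) - (1 / m : ℝ) • ∑ j, X (w j)‖ ≤
        2 * D / m + V * Real.sqrt (2 * τ / m)} = Set.univ := by
      refine Set.eq_univ_of_forall fun w => ?_
      simp only [hX0, Set.mem_ofPred_eq]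
      simp only [integral_zero, Finset.sum_const_zero, smul_zero, sub_zero, norm_zero]
      positivity
    rw [this, measure_univ]
    exact tsub_le_self
  set P := (Measure.pi fun _ : Fin m => Λ) with hP
  set F : (Fin m → Ω) → ℝ := fun w => ‖(∫ a, X a ∂Λ) - (1 / m : ℝ) • ∑ j, X (w j)‖ with hF
  have hFc : Continuous F := by fun_prop
  have hFe : ∀ w, F w = (1 / m : ℝ) * ‖∑ j, ((∫ a, X a ∂Λ) - X (w j))‖ := fun w => by
    rw [Finset.sum_sub_distrib, ← norm_smul_of_nonneg (by positivity), smul_sub]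
    simp only [hF, Finset.sum_const, Finset.card_univ, Fintype.card_fin]
    rw [← Nat.cast_smul_eq_nsmul ℝ, smul_smul, one_div_mul_cancel hm0.ne', one_smul]
  have hmean : ∫ w, F w ∂P ≤ 2 * D / m := by
    simp only [hFe]
    rw [integral_const_mul]
    have := mul_le_mul_of_nonneg_left (rff_symm Λ X hX V hV m D hD)
      (by positivity : (0 : ℝ) ≤ 1 / m)
    refine this.trans (le_of_eq (by ring))
  have hFB : ∀ w, |F w| ≤ ‖∫ a, X a ∂Λ‖ + V := fun w => by
    rw [hF, abs_norm]
    refine (norm_sub_le _ _).trans (add_le_add_right ?_ _)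
    rw [norm_smul_of_nonneg (by positivity)]
    have : ‖∑ j, X (w j)‖ ≤ m * V := (norm_sum_le _ _).trans
      ((Finset.sum_le_sum fun j _ => hV (w j)).trans (by simp))
    calc _ ≤ (1 / m : ℝ) * (m * V) := mul_le_mul_of_nonneg_left this (by positivity)
      _ = V := by field_simp
  have hFd : ∀ w i a, |F (Function.update w i a) - F w| ≤ 2 * V / m := fun w i a => by
    refine (abs_norm_sub_norm_le _ _).trans ?_
    rw [sub_sub_sub_cancel_left, ← smul_sub, norm_smul_of_nonneg (by positivity),
      ← Finset.sum_sub_distrib]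
    have : ∑ j, (X (w j) - X (Function.update w i a j)) = X (w i) - X a := by
      rw [Finset.sum_eq_single i]
      · simp
      · intro j _ hj
        simp [Function.update_of_ne hj]
      · simp
    rw [this]
    calc _ ≤ (1 / m : ℝ) * (V + V) := mul_le_mul_of_nonneg_left
            ((norm_sub_le _ _).trans (add_le_add (hV _) (hV _))) (by positivity)
      _ = _ := by ring
  have hmc := rff_mcdiarmid Λ m _ _ F hFc.measurable hFB hFd
    (V * Real.sqrt (2 * τ / m)) (by positivity)
  have hexp : - (V * Real.sqrt (2 * τ / m)) ^ 2 / (2 * (m * (2 * V / m) ^ 2 / 4)) = -τ := by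
    rw [mul_pow, Real.sq_sqrt (by positivity)]
    field_simp
    try ring
  rw [hexp, ← hP] at hmc
  have hmeas : MeasurableSet {w | F w ≤ 2 * D / m + V * Real.sqrt (2 * τ / m)} :=
    measurableSet_le hFc.measurable measurable_const
  have hcompl : P {w | F w ≤ 2 * D / m + V * Real.sqrt (2 * τ / m)}ᶜ ≤
      ENNReal.ofReal (Real.exp (-τ)) := by
    refine (measure_mono (t := {w | V * Real.sqrt (2 * τ / m) ≤ F w - ∫ w, F w ∂P}) ?_).trans ?_
    · intro w hw
      simp only [Set.mem_compl_iff, Set.mem_ofPred_eq, not_le] at hw ⊢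
      linarith
    · rw [← ofReal_measureReal]
      exact ENNReal.ofReal_le_ofReal hmc
  rw [← compl_compl {w | F w ≤ 2 * D / m + V * Real.sqrt (2 * τ / m)},
    prob_compl_eq_one_sub hmeas.compl]
  exact tsub_le_tsub_left hcompl _

lemma rff_lrnorm_eq {d : ℕ} (S : Set (EuclideanSpace ℝ (Fin d))) (hS : MeasurableSet (S ×ˢ S))
    [CompactSpace ↥(S ×ˢ S)] (r : ℝ) (hr : 1 < r) [Fact (1 ≤ ENNReal.ofReal r)]
    [IsFiniteMeasure (Measure.comap (Subtype.val : ↥(S ×ˢ S) → _) volume)]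
    (f : EuclideanSpace ℝ (Fin d) × EuclideanSpace ℝ (Fin d) → ℝ) (g : C(↥(S ×ˢ S), ℝ))
    (hfg : ∀ z : ↥(S ×ˢ S), f z = g z) :
    lrnorm d S r f = ‖ContinuousMap.toLp (E := ℝ) (ENNReal.ofReal r)
      (Measure.comap (Subtype.val : ↥(S ×ˢ S) → _) volume) ℝ g‖ := by
  have hr0 : 0 < r := by linarith
  rw [Lp.norm_def, eLpNorm_congr_ae (ContinuousMap.coeFn_toLp _ _)]
  have hmem : MemLp g (ENNReal.ofReal r)
      (Measure.comap (Subtype.val : ↥(S ×ˢ S) → _) volume) :=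
    (memLp_congr_ae (ContinuousMap.coeFn_toLp (𝕜 := ℝ) _ g)).1 (Lp.memLp _)
  rw [hmem.eLpNorm_eq_integral_rpow_norm (by simpa using hr0) ENNReal.ofReal_ne_top,
    ENNReal.toReal_ofReal (by positivity), ENNReal.toReal_ofReal hr0.le, lrnorm, one_div,
    ← integral_subtype_comap hS]
  simp only [hfg, Real.norm_eq_abs]

/-- High-probability bound on `‖k − k̂‖_{L^r(𝒮×𝒮)}` for random Fourier features. -/
theorem lr_norm_kernel_diff_bound (d m : ℕ) (hm : 1 ≤ m)
    (Λ : Measure (EuclideanSpace ℝ (Fin d))) [IsProbabilityMeasure Λ]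
    (S : Set (EuclideanSpace ℝ (Fin d))) (hS : IsCompact S)
    (r : ℝ) (hr : 1 < r) (C : ℝ) (hC : 0 < C)
    (htype : ∀ (N : ℕ)
      (f : Fin N → (EuclideanSpace ℝ (Fin d) × EuclideanSpace ℝ (Fin d) → ℝ)),
      (∀ j, MemLp (f j) (ENNReal.ofReal r) (volume.restrict (S ×ˢ S))) →
      (2 ^ N : ℝ)⁻¹ * ∑ ε : Fin N → Bool,
          lrnorm d S r (fun z => ∑ j, (if ε j then (1 : ℝ) else -1) * f j z) ≤
        C * (∑ j, lrnorm d S r (f j) ^ min 2 r) ^ (1 / min 2 r))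
    (τ : ℝ) (hτ : 0 < τ) :
    1 - ENNReal.ofReal (Real.exp (-τ)) ≤
      Measure.pi (fun _ : Fin m => Λ)
        {w | lrnorm d S r (fun z =>
              (∫ ω, Real.cos ⟪ω, z.1 - z.2⟫ ∂Λ) -
                (1 / m) * ∑ j, Real.cos ⟪w j, z.1 - z.2⟫) ≤
          (volume S).toReal ^ (2 / r) *
            (2 * C * (m : ℝ) ^ (max ((1 : ℝ) / 2) (1 / r) - 1) + Real.sqrt (2 * τ / m))} := by
  have hr0 : 0 < r := by linarith
  have hm0 : (0 : ℝ) < m := by exact_mod_cast hm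
  have hK : IsCompact (S ×ˢ S) := hS.prod hS
  have hKm : MeasurableSet (S ×ˢ S) := hK.measurableSet
  have : CompactSpace ↥(S ×ˢ S) := isCompact_iff_compactSpace.1 hK
  have : Fact (1 ≤ ENNReal.ofReal r) := ⟨by simpa using hr.le⟩
  set ν : Measure ↥(S ×ˢ S) := Measure.comap Subtype.val volume with hν
  have hνu : ν Set.univ = volume S * volume S := by
    rw [hν, (MeasurableEmbedding.subtype_coe hKm).comap_apply, Set.image_univ,
      Subtype.range_coe, Measure.volume_eq_prod, Measure.prod_prod]
  have : IsFiniteMeasure ν := ⟨by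
    rw [hνu]; exact ENNReal.mul_lt_top hS.measure_lt_top hS.measure_lt_top⟩
  set V : ℝ := (volume S).toReal ^ (2 / r) with hVdef
  have hV0 : 0 ≤ V := by positivity
  let Φ : C(EuclideanSpace ℝ (Fin d), C(↥(S ×ˢ S), ℝ)) := ContinuousMap.curry
    ⟨fun p => Real.cos ⟪p.1, p.2.1.1 - p.2.1.2⟫, by fun_prop⟩
  have hΦ : ∀ ω z, Φ ω z = Real.cos ⟪ω, z.1.1 - z.1.2⟫ := fun ω z => rfl
  let T := ContinuousMap.toLp (E := ℝ) (ENNReal.ofReal r) ν ℝ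
  let X : EuclideanSpace ℝ (Fin d) → Lp ℝ (ENNReal.ofReal r) ν := fun ω => T (Φ ω)
  have hXc : Continuous X := T.continuous.comp Φ.continuous
  have hXV : ∀ ω, ‖X ω‖ ≤ V := fun ω => by
    have h := Lp.norm_le_of_ae_bound (f := X ω) zero_le_one (by
      filter_upwards [ContinuousMap.coeFn_toLp (p := ENNReal.ofReal r) (𝕜 := ℝ) ν (Φ ω)] with z hz
      rw [hz, hΦ]
      exact Real.abs_cos_le_one _)
    refine h.trans (le_of_eq ?_)
    have : (measureUnivNNReal ν : ℝ) = (volume S).toReal ^ (2 : ℝ) := by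
      rw [measureUnivNNReal, ENNReal.coe_toNNReal_eq_toReal, hνu, ENNReal.toReal_mul,
        Real.rpow_two, sq]
    rw [this, mul_one, ENNReal.toReal_ofReal hr0.le, ← Real.rpow_mul ENNReal.toReal_nonneg,
      hVdef, div_eq_mul_inv]
  have hΦi : Integrable (fun ω => Φ ω) Λ :=
    Integrable.of_bound Φ.continuous.aestronglyMeasurable 1 (Filter.Eventually.of_forall fun ω => by
      rw [ContinuousMap.norm_le _ zero_le_one]
      intro z
      rw [hΦ]
      exact Real.abs_cos_le_one _)
  have hint : ∫ ω, X ω ∂Λ = T (∫ ω, Φ ω ∂Λ) := T.integral_comp_comm hΦi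
  have hintz : ∀ z, (∫ ω, Φ ω ∂Λ) z = ∫ ω, Real.cos ⟪ω, z.1.1 - z.1.2⟫ ∂Λ := fun z =>
    ((ContinuousMap.evalCLM ℝ z).integral_comp_comm hΦi).symm
  set q : ℝ := min 2 r with hq
  have hq0 : 0 < q := lt_min two_pos hr0
  have hqi : 1 / q = max ((1 : ℝ) / 2) (1 / r) := by
    rcases le_total 2 r with h | h
    · rw [hq, min_eq_left h, max_eq_left (one_div_le_one_div_of_le two_pos h)]
    · rw [hq, min_eq_right h, max_eq_right (one_div_le_one_div_of_le hr0 h)]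
  have hD : ∀ w : Fin m → EuclideanSpace ℝ (Fin d), (2 ^ m : ℝ)⁻¹ * ∑ ε : Fin m → Bool,
      ‖∑ j, (if ε j then (1 : ℝ) else -1) • X (w j)‖ ≤ C * ((m : ℝ) ^ (1 / q) * V) := by
    intro w
    have h := htype m (fun j z => Real.cos ⟪w j, z.1 - z.2⟫) (fun j => by
      have : IsFiniteMeasure ((volume : Measure (EuclideanSpace ℝ (Fin d) ×
        EuclideanSpace ℝ (Fin d))).restrict (S ×ˢ S)) := ⟨by
          rw [Measure.restrict_apply_univ]; exact hK.measure_lt_top⟩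
      refine MemLp.of_bound (Continuous.aestronglyMeasurable (by fun_prop)) 1
        (Filter.Eventually.of_forall fun z => Real.abs_cos_le_one _))
    have e1 : ∀ ε : Fin m → Bool, lrnorm d S r (fun z => ∑ j, (if ε j then (1 : ℝ) else -1) *
        Real.cos ⟪w j, z.1 - z.2⟫) = ‖∑ j, (if ε j then (1 : ℝ) else -1) • X (w j)‖ := fun ε => by
      rw [rff_lrnorm_eq S hKm r hr _ (∑ j, (if ε j then (1 : ℝ) else -1) • Φ (w j)) (fun z => by
        simp only [ContinuousMap.sum_apply, ContinuousMap.smul_apply, smul_eq_mul, hΦ])]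
      rw [map_sum]
      simp only [map_smul]
      rfl
    have e2 : ∀ j, lrnorm d S r (fun z => Real.cos ⟪w j, z.1 - z.2⟫) = ‖X (w j)‖ := fun j =>
      rff_lrnorm_eq S hKm r hr _ (Φ (w j)) (fun z => rfl)
    simp only [e1, e2] at h
    refine h.trans (mul_le_mul_of_nonneg_left ?_ hC.le)
    calc (∑ j, ‖X (w j)‖ ^ q) ^ (1 / q) ≤ (m * V ^ q) ^ (1 / q) := by
          refine Real.rpow_le_rpow (Finset.sum_nonneg fun j _ => by positivity) ?_ (by positivity)
          calc _ ≤ ∑ j : Fin m, V ^ q := Finset.sum_le_sum fun j _ =>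
                Real.rpow_le_rpow (norm_nonneg _) (hXV _) hq0.le
            _ = _ := by simp
      _ = _ := by
          rw [Real.mul_rpow hm0.le (by positivity), ← Real.rpow_mul hV0, mul_one_div_cancel hq0.ne',
            Real.rpow_one]
  have main := rff_abstract Λ X hXc V hXV m hm _ hD τ hτ
  refine main.trans (le_of_eq ?_)
  congr 1
  ext w
  simp only [Set.mem_ofPred_eq]
  have e3 : lrnorm d S r (fun z => (∫ ω, Real.cos ⟪ω, z.1 - z.2⟫ ∂Λ) -
      (1 / m) * ∑ j, Real.cos ⟪w j, z.1 - z.2⟫) =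
      ‖(∫ a, X a ∂Λ) - (1 / m : ℝ) • ∑ j, X (w j)‖ := by
    rw [rff_lrnorm_eq S hKm r hr _ ((∫ ω, Φ ω ∂Λ) - (1 / m : ℝ) • ∑ j, Φ (w j)) (fun z => by
      simp [ContinuousMap.sum_apply, hΦ, hintz]), hint, map_sub, map_smul, map_sum]
  have e4 : 2 * (C * ((m : ℝ) ^ (1 / q) * V)) / m + V * Real.sqrt (2 * τ / m) =
      V * (2 * C * (m : ℝ) ^ (max ((1 : ℝ) / 2) (1 / r) - 1) + Real.sqrt (2 * τ / m)) := by
    rw [← hqi, Real.rpow_sub hm0, Real.rpow_one]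
    ring
  rw [e3, e4]
end
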